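/- arXiv:2006.14044 — 10 statements merged into one kernel-verified Lean document; each statement's English description precedes it below -/
import Mathlib

section
/- Let A be an invertible column-stochastic N×N real matrix, let P be a probability vector on {1,…,N}, and let O : {1,…,N} → ℝ. Let s¹,…,s^M be independent random variables each distributed according to the probability vector A·P. Then the random variable ξ = M⁻¹ Σ_{i=1}^{M} Σ_{x} O(x)·(A⁻¹)_{x,sⁱ} satisfies E[ξ] = Σ_x O(x)·P(x); that is, ξ is an unbiased estimator of the ideal mean value. -/
open Finset

/-- Under a product of identical weights of total mass one, the mean of a function of a single
coordinate is its mean under the one-coordinate weight. -/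
theorem sum_prod_weight_mul_apply {ι κ R : Type*} [Fintype ι] [DecidableEq ι] [Fintype κ]
    [CommSemiring R] (p : κ → R) (hp : ∑ y, p y = 1) (f : κ → R) (j : ι) :
    ∑ s : ι → κ, (∏ i, p (s i)) * f (s j) = ∑ y, p y * f y := by
  have h (s : ι → κ) : (∏ i, p (s i)) * f (s j)
      = ∏ i, (p (s i) * if i = j then f (s i) else 1) := by
    rw [Finset.prod_mul_distrib, Fintype.prod_ite_eq']
  simp_rw [h]
  rw [← Fintype.piFinset_univ,
    ← Finset.prod_univ_sum (fun _ : ι => (Finset.univ : Finset κ))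
      (fun i y => p y * if i = j then f y else 1),
    Fintype.prod_eq_single j]
  · simp
  · intro i hi
    simp [hi, hp]

/-- A matrix whose columns sum to one preserves the sum of the entries of a vector. -/
theorem sum_mulVec_of_col_sum_eq_one {m n R : Type*} [Fintype m] [Fintype n] [CommSemiring R]
    (A : Matrix m n R) (hA : ∀ j, ∑ i, A i j = 1) (v : n → R) :
    ∑ i, A.mulVec v i = ∑ j, v j := by
  simp only [Matrix.mulVec, dotProduct]
  rw [Finset.sum_comm]
  simp [← Finset.sum_mul, hA]

/-- Reweighting an observable by the inverse matrix undoes the action of the matrix. -/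
theorem sum_mulVec_mul_inv {n R : Type*} [Fintype n] [DecidableEq n] [CommRing R]
    (A : Matrix n n R) (hA : IsUnit A.det) (v w : n → R) :
    ∑ y, A.mulVec v y * ∑ x, w x * A⁻¹ x y = ∑ x, w x * v x := by
  change A.mulVec v ⬝ᵥ Matrix.vecMul w A⁻¹ = w ⬝ᵥ v
  rw [dotProduct_comm, ← Matrix.dotProduct_mulVec, Matrix.mulVec_mulVec,
    Matrix.nonsing_inv_mul A hA, Matrix.one_mulVec]

/-- Unbiasedness of the error-mitigated mean value estimator `ξ`.
The expectation is taken over i.i.d. samples `s¹,…,s^M`, i.e. over the product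
measure on `Fin M → Fin N` whose weight at `s` is `∏ i, (A·P) (s i)`. -/
theorem unbiased_error_mitigation (N M : ℕ) (hM : 0 < M)
    (A : Matrix (Fin N) (Fin N) ℝ) (hA : IsUnit A.det)
    (hAnonneg : ∀ i j, 0 ≤ A i j) (hAcol : ∀ j, ∑ i, A i j = 1)
    (P : Fin N → ℝ) (hP : ∀ x, 0 ≤ P x) (hP1 : ∑ x, P x = 1)
    (O : Fin N → ℝ) :
    ∑ s : Fin M → Fin N,
        (∏ i, ∑ x, A (s i) x * P x) *
          ((M : ℝ)⁻¹ * ∑ i, ∑ x, O x * (A⁻¹) x (s i))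
      = ∑ x, O x * P x := by
  have hM' : (M : ℝ) ≠ 0 := by exact_mod_cast hM.ne'
  have hp : ∑ y, A.mulVec P y = 1 := (sum_mulVec_of_col_sum_eq_one A hAcol P).trans hP1
  have key (j : Fin M) :
      ∑ s : Fin M → Fin N, (∏ i, A.mulVec P (s i)) * ∑ x, O x * A⁻¹ x (s j)
        = ∑ x, O x * P x :=
    (sum_prod_weight_mul_apply _ hp (fun y => ∑ x, O x * A⁻¹ x y) j).trans
      (sum_mulVec_mul_inv A hA P O)
  calc
    _ = ∑ s : Fin M → Fin N, (M : ℝ)⁻¹ *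
          ∑ j, (∏ i, A.mulVec P (s i)) * ∑ x, O x * A⁻¹ x (s j) :=
        Finset.sum_congr rfl fun s _ =>
          (mul_left_comm _ _ _).trans (congrArg _ (Finset.mul_sum _ _ _))
    _ = ∑ x, O x * P x := by
        rw [← Finset.mul_sum, Finset.sum_comm, Finset.sum_congr rfl fun j _ => key j]
        simp [hM']
end

section
/- Let A be an invertible column-stochastic N×N real matrix, let P be a probability vector on {1,…,N}, and let O : {1,…,N} → ℝ satisfy |O(x)| ≤ 1 for all x. Let s¹,…,s^M be independent random variables each distributed according to the probability vector A·P, and let ξ = M⁻¹ Σ_{i=1}^{M} Σ_{x} O(x)·(A⁻¹)_{x,sⁱ}. Let Γ = max_y Σ_x |(A⁻¹)_{x,y}|. Then the variance of ξ is at most Γ²/M (equivalently, the standard deviation of ξ is at most Γ·M^{-1/2}). -/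
open Finset

section ProductWeights

variable {ι α : Type*} [Fintype ι] [DecidableEq ι] [Fintype α] {q : α → ℝ}

lemma sum_prod_weight_mul_prod (hq : ∑ a, q a = 1) (T : Finset ι) (g : ι → α → ℝ) :
    ∑ s : ι → α, (∏ k, q (s k)) * ∏ i ∈ T, g i (s i) = ∏ i ∈ T, ∑ a, q a * g i a := by
  have h := Fintype.prod_sum (fun (i : ι) (a : α) => q a * if i ∈ T then g i a else 1)
  have hl : ∏ i, ∑ a, q a * (if i ∈ T then g i a else 1) = ∏ i ∈ T, ∑ a, q a * g i a := by
    rw [← Finset.prod_subset (Finset.subset_univ T)]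
    · exact Finset.prod_congr rfl fun i hi => by simp [hi]
    · intro i _ hi
      simp [hi, hq]
  rw [← hl, h]
  refine Finset.sum_congr rfl fun s _ => ?_
  rw [Finset.prod_mul_distrib, Finset.prod_ite_mem, Finset.univ_inter]

lemma sum_prod_weight_mul_apply_s1 (hq : ∑ a, q a = 1) (i : ι) (g : α → ℝ) :
    ∑ s : ι → α, (∏ k, q (s k)) * g (s i) = ∑ a, q a * g a := by
  simpa using sum_prod_weight_mul_prod hq {i} (fun _ => g)

lemma sum_prod_weight_mul_apply_mul_apply (hq : ∑ a, q a = 1) {i j : ι} (hij : i ≠ j)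
    (g : α → ℝ) :
    ∑ s : ι → α, (∏ k, q (s k)) * (g (s i) * g (s j)) = (∑ a, q a * g a) ^ 2 := by
  simpa [Finset.prod_pair hij, sq] using sum_prod_weight_mul_prod hq {i, j} (fun _ => g)

lemma sum_prod_weight_mul_sum (hq : ∑ a, q a = 1) (g : α → ℝ) :
    ∑ s : ι → α, (∏ k, q (s k)) * ∑ i, g (s i) = Fintype.card ι * ∑ a, q a * g a := by
  simp_rw [Finset.mul_sum]
  rw [Finset.sum_comm]
  simp [sum_prod_weight_mul_apply_s1 hq, Finset.mul_sum]

lemma sum_prod_weight_mul_sum_sq (hq : ∑ a, q a = 1) {g : α → ℝ}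
    (hg : ∑ a, q a * g a = 0) :
    ∑ s : ι → α, (∏ k, q (s k)) * (∑ i, g (s i)) ^ 2
      = Fintype.card ι * ∑ a, q a * g a ^ 2 := by
  have hcov (i j : ι) : ∑ s : ι → α, (∏ k, q (s k)) * (g (s i) * g (s j))
      = if i = j then ∑ a, q a * g a ^ 2 else 0 := by
    split_ifs with hij
    · subst hij
      simpa [← sq] using sum_prod_weight_mul_apply_s1 hq i (fun a => g a ^ 2)
    · rw [sum_prod_weight_mul_apply_mul_apply hq hij, hg]
      simp
  calc _ = ∑ s : ι → α, ∑ i, ∑ j, (∏ k, q (s k)) * (g (s i) * g (s j)) := by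
        refine Finset.sum_congr rfl fun s _ => ?_
        rw [sq, Finset.sum_mul_sum, Finset.mul_sum]
        simp_rw [Finset.mul_sum]
    _ = ∑ i : ι, ∑ j : ι, ∑ s : ι → α, (∏ k, q (s k)) * (g (s i) * g (s j)) := by
        rw [Finset.sum_comm]
        exact Finset.sum_congr rfl fun i _ => Finset.sum_comm
    _ = _ := by simp [hcov]

lemma sum_weight_mul_sub_mean_sq_le (hq0 : ∀ a, 0 ≤ q a) (hq : ∑ a, q a = 1) {f : α → ℝ}
    {C : ℝ} (hf : ∀ a, |f a| ≤ C) :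
    ∑ a, q a * (f a - ∑ b, q b * f b) ^ 2 ≤ C ^ 2 := by
  set m := ∑ b, q b * f b with hm
  have hvar : ∑ a, q a * (f a - m) ^ 2 = ∑ a, q a * f a ^ 2 - m ^ 2 := by
    have h (a : α) : q a * (f a - m) ^ 2
        = q a * f a ^ 2 - 2 * m * (q a * f a) + q a * m ^ 2 := by ring
    simp_rw [h, Finset.sum_add_distrib, Finset.sum_sub_distrib, ← Finset.mul_sum,
      ← Finset.sum_mul, hq, ← hm]
    ring
  have hsq : ∑ a, q a * f a ^ 2 ≤ ∑ a, q a * C ^ 2 :=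
    Finset.sum_le_sum fun a _ => mul_le_mul_of_nonneg_left
      (sq_le_sq' (abs_le.mp (hf a)).1 (abs_le.mp (hf a)).2) (hq0 a)
  rw [← Finset.sum_mul, hq, one_mul] at hsq
  rw [hvar]
  nlinarith [sq_nonneg m]

end ProductWeights

/-- The variance of the error-mitigated estimator `ξ` is at most `Γ²/M`,
where `Γ = max_y ∑_x |(A⁻¹)_{x,y}|`.  The expectation/variance is taken over
i.i.d. samples `s¹,…,s^M` distributed according to `A·P`, i.e. over the product
measure on `Fin M → Fin N` with weight `∏ i, (A·P) (s i)`. -/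
theorem variance_error_mitigation (N M : ℕ) (hM : 0 < M)
    (A : Matrix (Fin N) (Fin N) ℝ) (hA : IsUnit A.det)
    (hAnonneg : ∀ i j, 0 ≤ A i j) (hAcol : ∀ j, ∑ i, A i j = 1)
    (P : Fin N → ℝ) (hP : ∀ x, 0 ≤ P x) (hP1 : ∑ x, P x = 1)
    (O : Fin N → ℝ) (hO : ∀ x, |O x| ≤ 1)
    (Γ : ℝ) (hΓ : IsGreatest {g : ℝ | ∃ y, g = ∑ x, |(A⁻¹) x y|} Γ)
    (ξ : (Fin M → Fin N) → ℝ)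
    (hξ : ∀ s, ξ s = (M : ℝ)⁻¹ * ∑ i, ∑ x, O x * (A⁻¹) x (s i))
    (μ : ℝ) (hμ : μ = ∑ s : Fin M → Fin N, (∏ i, ∑ x, A (s i) x * P x) * ξ s) :
    ∑ s : Fin M → Fin N, (∏ i, ∑ x, A (s i) x * P x) * (ξ s - μ) ^ 2
      ≤ Γ ^ 2 / M := by
  set q : Fin N → ℝ := fun y => ∑ x, A y x * P x with hqdef
  set f : Fin N → ℝ := fun y => ∑ x, O x * (A⁻¹) x y with hfdef
  have hM' : (M : ℝ) ≠ 0 := by positivity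
  have hq0 (y : Fin N) : 0 ≤ q y :=
    Finset.sum_nonneg fun x _ => mul_nonneg (hAnonneg y x) (hP x)
  have hq : ∑ y, q y = 1 := by
    rw [hqdef, Finset.sum_comm]
    simp_rw [← Finset.sum_mul, hAcol, one_mul, hP1]
  have hf (y : Fin N) : |f y| ≤ Γ := by
    refine le_trans ?_ (hΓ.2 ⟨y, rfl⟩)
    refine (Finset.abs_sum_le_sum_abs _ _).trans (Finset.sum_le_sum fun x _ => ?_)
    rw [abs_mul]
    exact mul_le_of_le_one_left (abs_nonneg _) (hO x)
  have hξ' (s : Fin M → Fin N) : ξ s = (M : ℝ)⁻¹ * ∑ i, f (s i) := hξ s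
  have hmean : μ = ∑ y, q y * f y := by
    change μ = ∑ s : Fin M → Fin N, (∏ i, q (s i)) * ξ s at hμ
    simp_rw [hμ, hξ', mul_left_comm _ (M : ℝ)⁻¹]
    rw [← Finset.mul_sum, sum_prod_weight_mul_sum hq, Fintype.card_fin,
      inv_mul_cancel_left₀ hM']
  have hcentered : ∑ y, q y * (f y - μ) = 0 := by
    simp_rw [mul_sub, Finset.sum_sub_distrib, ← Finset.sum_mul, hq, ← hmean]
    ring
  have hdev (s : Fin M → Fin N) : (∏ i, q (s i)) * (ξ s - μ) ^ 2
      = ((M : ℝ)⁻¹) ^ 2 * ((∏ i, q (s i)) * (∑ i, (f (s i) - μ)) ^ 2) := by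
    rw [hξ', Finset.sum_sub_distrib, Finset.sum_const, Finset.card_univ, Fintype.card_fin,
      nsmul_eq_mul]
    field_simp
  change ∑ s : Fin M → Fin N, (∏ i, q (s i)) * (ξ s - μ) ^ 2 ≤ _
  simp_rw [hdev]
  rw [← Finset.mul_sum, sum_prod_weight_mul_sum_sq hq (g := fun y => f y - μ) hcentered,
    Fintype.card_fin, hmean]
  calc _ = (∑ y, q y * (f y - ∑ b, q b * f b) ^ 2) / M := by field_simp
    _ ≤ Γ ^ 2 / M := by
      gcongr
      exact sum_weight_mul_sub_mean_sq_le hq0 hq hf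
end

section
/- A real N×N matrix M can be written as a finite linear combination M = Σ_a c_a S_a, where each S_a is a column-stochastic N×N matrix and each c_a is a real coefficient, if and only if all column sums of M are equal (i.e., Σ_i M_{i,j} takes the same value for every column j). -/
open Finset

/-- A matrix with nonnegative entries and constant positive column sum `D` is `D` times a
column-stochastic matrix. -/
theorem column_stochastic_inv_smul {n : Type*} [Fintype n] {A : Matrix n n ℝ} {D : ℝ}
    (hD : 0 < D) (hA : ∀ i j, 0 ≤ A i j) (hsum : ∀ j, ∑ i, A i j = D) :
    (∀ i j, 0 ≤ (D⁻¹ • A) i j) ∧ ∀ j, ∑ i, (D⁻¹ • A) i j = 1 := by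
  refine ⟨fun i j => mul_nonneg (inv_nonneg.mpr hD.le) (hA i j), fun j => ?_⟩
  simp only [Matrix.smul_apply, smul_eq_mul]
  rw [← Finset.mul_sum, hsum j, inv_mul_cancel₀ hD.ne']

/-- A real `N×N` matrix is a finite linear combination of column-stochastic
matrices if and only if all of its column sums are equal. -/
theorem linear_combination_stochastic_iff_equal_column_sums
    (N : ℕ) (M : Matrix (Fin N) (Fin N) ℝ) :
    (∃ (k : ℕ) (c : Fin k → ℝ) (S : Fin k → Matrix (Fin N) (Fin N) ℝ),
        (∀ a, (∀ i j, 0 ≤ S a i j) ∧ ∀ j, ∑ i, S a i j = 1) ∧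
        M = ∑ a, c a • S a) ↔
      ∀ j j' : Fin N, ∑ i, M i j = ∑ i, M i j' := by
  constructor
  · rintro ⟨k, c, S, hS, rfl⟩
    have colSum (j : Fin N) : ∑ i, (∑ a, c a • S a) i j = ∑ a, c a := by
      simp only [Matrix.sum_apply, Matrix.smul_apply, smul_eq_mul]
      rw [Finset.sum_comm]
      simp only [← Finset.mul_sum, (hS _).2, mul_one]
    intro j j'
    rw [colSum, colSum]
  · intro h
    rcases Nat.eq_zero_or_pos N with rfl | hN
    · exact ⟨0, Fin.elim0, Fin.elim0, fun a => a.elim0, Subsingleton.elim _ _⟩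
    have hN' : (0 : ℝ) < N := Nat.cast_pos.mpr hN
    obtain ⟨B, hB⟩ := (Set.finite_range fun p : Fin N × Fin N => M p.1 p.2).bddBelow
    have entry_ge (i j : Fin N) : B ≤ M i j := hB ⟨(i, j), rfl⟩
    let J : Matrix (Fin N) (Fin N) ℝ := Matrix.of fun _ _ => 1
    -- Subtracting a multiple of the all-ones matrix makes every entry at least `1`.
    let A : Matrix (Fin N) (Fin N) ℝ := M - (B - 1) • J
    have one_le (i j : Fin N) : 1 ≤ A i j := by
      simp only [A, J, Matrix.sub_apply, Matrix.smul_apply, Matrix.of_apply, smul_eq_mul]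
      linarith [entry_ge i j]
    let j₀ : Fin N := ⟨0, hN⟩
    have A_sum (j : Fin N) : ∑ i, A i j = ∑ i, A i j₀ := by
      simp only [A, J, Matrix.sub_apply, Matrix.smul_apply, Matrix.of_apply,
        Finset.sum_sub_distrib, h j j₀]
    have D_pos : 0 < ∑ i, A i j₀ :=
      Finset.sum_pos (fun i _ => zero_lt_one.trans_le (one_le i j₀)) ⟨j₀, Finset.mem_univ _⟩
    refine ⟨2, ![∑ i, A i j₀, (B - 1) * N], ![(∑ i, A i j₀)⁻¹ • A, (N : ℝ)⁻¹ • J],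
      Fin.forall_fin_two.mpr ⟨?_, ?_⟩, ?_⟩
    · exact column_stochastic_inv_smul D_pos (fun i j => zero_le_one.trans (one_le i j)) A_sum
    · exact column_stochastic_inv_smul hN' (fun _ _ => zero_le_one) (fun _ => by simp [J])
    · simp only [Fin.sum_univ_two, Matrix.cons_val_zero, Matrix.cons_val_one, smul_smul]
      rw [mul_inv_cancel₀ D_pos.ne', one_smul, mul_assoc, mul_inv_cancel₀ hN'.ne', mul_one,
        sub_add_cancel]
end

section
/- Let M be a real N×N matrix all of whose column sums are equal. Then there exists a finite decomposition M = Σ_a c_a S_a, where each S_a is a column-stochastic N×N matrix and each c_a is a real coefficient, such that Σ_a |c_a| = Γ(M), where Γ(M) = max_j Σ_i |M_{i,j}| is the maximum column 1-norm of M. -/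
open Finset

/-- A nonnegative matrix with constant column sums `s` is `s` times a column-stochastic matrix. -/
theorem exists_stochastic_eq_smul {n : Type*} [Fintype n] [DecidableEq n]
    (A : Matrix n n ℝ) (s : ℝ) (hA : ∀ i j, 0 ≤ A i j) (hs : ∀ j, ∑ i, A i j = s) :
    ∃ S : Matrix n n ℝ, ((∀ i j, 0 ≤ S i j) ∧ ∀ j, ∑ i, S i j = 1) ∧ A = s • S := by
  by_cases h : s = 0
  · refine ⟨1, ⟨fun i j => ?_, fun j => ?_⟩, ?_⟩
    · rw [Matrix.one_apply]
      split_ifs <;> norm_num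
    · simp [Matrix.one_apply]
    · ext i j
      have := (sum_eq_zero_iff_of_nonneg fun i _ => hA i j).1 ((hs j).trans h) i (mem_univ i)
      simp [h, this]
  · refine ⟨s⁻¹ • A, ⟨fun i j => ?_, fun j => ?_⟩, ?_⟩
    · have : 0 ≤ s := hs j ▸ sum_nonneg fun i _ => hA i j
      exact mul_nonneg (inv_nonneg.2 this) (hA i j)
    · simp only [Matrix.smul_apply, smul_eq_mul, ← mul_sum, hs j]
      exact inv_mul_cancel₀ h
    · rw [smul_smul, mul_inv_cancel₀ h, one_smul]

/-- A matrix whose column sums are all equal admits a decomposition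
`M = ∑ a, c a • S a` into column-stochastic matrices with
`∑ a, |c a| = Γ(M)`, the maximum column 1-norm of `M`. -/
theorem optimal_stochastic_decomposition
    (N : ℕ) (M : Matrix (Fin N) (Fin N) ℝ)
    (hM : ∀ j j' : Fin N, ∑ i, M i j = ∑ i, M i j')
    (Γ : ℝ) (hΓ : IsGreatest {g : ℝ | ∃ j, g = ∑ i, |M i j|} Γ) :
    ∃ (k : ℕ) (c : Fin k → ℝ) (S : Fin k → Matrix (Fin N) (Fin N) ℝ),
      (∀ a, (∀ i j, 0 ≤ S a i j) ∧ ∀ j, ∑ i, S a i j = 1) ∧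
      M = ∑ a, c a • S a ∧ ∑ a, |c a| = Γ := by
  obtain ⟨⟨j₀, hj₀⟩, hmax⟩ := hΓ
  have hle (j : Fin N) : ∑ i, |M i j| ≤ Γ := hmax ⟨j, rfl⟩
  set σ := ∑ i, M i j₀
  have hσΓ : |σ| ≤ Γ := hj₀ ▸ abs_sum_le_sum_abs _ _
  -- The deficit of each column is added on the diagonal of both the positive and negative parts.
  let D : Matrix (Fin N) (Fin N) ℝ := Matrix.diagonal fun j => (Γ - ∑ i, |M i j|) / 2
  have hD (i j) : 0 ≤ D i j := by
    simp only [D, Matrix.diagonal_apply]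
    split_ifs
    · linarith [hle i]
    · exact le_rfl
  have hDsum (j) : ∑ i, D i j = (Γ - ∑ i, |M i j|) / 2 := by
    simp [D, Matrix.diagonal_apply]
  obtain ⟨S, hS, hPS⟩ := exists_stochastic_eq_smul
    (fun i j => (|M i j| + M i j) / 2 + D i j) ((Γ + σ) / 2)
    (fun i j => by linarith [hD i j, neg_abs_le (M i j)])
    (fun j => by
      rw [sum_add_distrib, ← sum_div, sum_add_distrib, hDsum, hM j j₀]
      ring)
  obtain ⟨T, hT, hQT⟩ := exists_stochastic_eq_smul
    (fun i j => (|M i j| - M i j) / 2 + D i j) ((Γ - σ) / 2)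
    (fun i j => by linarith [hD i j, le_abs_self (M i j)])
    (fun j => by
      rw [sum_add_distrib, ← sum_div, sum_sub_distrib, hDsum, hM j j₀]
      ring)
  refine ⟨2, ![(Γ + σ) / 2, -((Γ - σ) / 2)], ![S, T], ?_, ?_, ?_⟩
  · exact Fin.forall_fin_two.2 ⟨hS, hT⟩
  · ext i j
    have h₁ := congrFun (congrFun hPS i) j
    have h₂ := congrFun (congrFun hQT i) j
    simp only [Matrix.smul_apply, smul_eq_mul] at h₁ h₂
    simp only [Fin.sum_univ_two, Matrix.cons_val_zero, Matrix.cons_val_one, Matrix.add_apply,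
      Matrix.smul_apply, smul_eq_mul]
    linarith
  · obtain ⟨h₁, h₂⟩ := abs_le.1 hσΓ
    simp only [Fin.sum_univ_two, Matrix.cons_val_zero, Matrix.cons_val_one, abs_neg]
    rw [abs_of_nonneg (by linarith), abs_of_nonneg (by linarith)]
    ring
end

section
/- Let A be an invertible column-stochastic N×N real matrix and let Γ = max_y Σ_x |(A⁻¹)_{x,y}|. Then: (i) there exist column-stochastic N×N matrices S_α and real coefficients c_α (finitely many) with A⁻¹ = Σ_α c_α S_α and Σ_α |c_α| = Γ; and (ii) every such decomposition A⁻¹ = Σ_α c_α S_α into column-stochastic matrices satisfies Σ_α |c_α| ≥ Γ. -/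
open Finset

/-- The inverse of an invertible matrix with unit column sums has unit column sums. -/
lemma Matrix.sum_inv_col_eq_one {n R : Type*} [Fintype n] [DecidableEq n] [CommRing R]
    {A : Matrix n n R} (hA : IsUnit A.det) (hcol : ∀ j, ∑ i, A i j = 1) (j : n) :
    ∑ i, A⁻¹ i j = 1 := by
  have h : Matrix.vecMul 1 A = 1 := by
    ext j
    simpa [Matrix.vecMul, dotProduct] using hcol j
  have h' : Matrix.vecMul 1 A⁻¹ = 1 := by
    conv_lhs => rw [← h]
    rw [Matrix.vecMul_vecMul, Matrix.mul_nonsing_inv _ hA, Matrix.vecMul_one]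
  simpa [Matrix.vecMul, dotProduct] using congrFun h' j

/-- A nonnegative matrix with constant column sums is a multiple of a column-stochastic matrix. -/
lemma Matrix.exists_colStochastic_smul_eq {n : Type*} [Fintype n] [DecidableEq n]
    {M : Matrix n n ℝ} {q : ℝ} (hq : 0 ≤ q) (hM : ∀ i j, 0 ≤ M i j)
    (hcol : ∀ j, ∑ i, M i j = q) :
    ∃ S : Matrix n n ℝ, ((∀ i j, 0 ≤ S i j) ∧ ∀ j, ∑ i, S i j = 1) ∧ M = q • S := by
  rcases hq.eq_or_lt with rfl | hq
  · refine ⟨1, ⟨fun i j => ?_, fun j => by simp [Matrix.one_apply]⟩, ?_⟩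
    · rw [Matrix.one_apply]
      split_ifs <;> simp
    · ext i j
      have := (Finset.sum_eq_zero_iff_of_nonneg fun i _ => hM i j).1 (hcol j) i (mem_univ i)
      simpa using this
  · refine ⟨q⁻¹ • M, ⟨fun i j => mul_nonneg (inv_nonneg.2 hq.le) (hM i j), fun j => ?_⟩, ?_⟩
    · simp [← Finset.mul_sum, hcol, hq.ne']
    · rw [smul_inv_smul₀ hq.ne']

/-- For an invertible column-stochastic matrix `A` with
`Γ = max_y ∑_x |(A⁻¹)_{x,y}|`:
(i) `A⁻¹` admits a decomposition into column-stochastic matrices with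
1-norm of the coefficients equal to `Γ`, and
(ii) every such decomposition has coefficient 1-norm at least `Γ`. -/
theorem inverse_stochastic_decomposition
    (N : ℕ) (A : Matrix (Fin N) (Fin N) ℝ) (hA : IsUnit A.det)
    (hAnonneg : ∀ i j, 0 ≤ A i j) (hAcol : ∀ j, ∑ i, A i j = 1)
    (Γ : ℝ) (hΓ : IsGreatest {g : ℝ | ∃ y, g = ∑ x, |(A⁻¹) x y|} Γ) :
    (∃ (k : ℕ) (c : Fin k → ℝ) (S : Fin k → Matrix (Fin N) (Fin N) ℝ),
        (∀ a, (∀ i j, 0 ≤ S a i j) ∧ ∀ j, ∑ i, S a i j = 1) ∧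
        A⁻¹ = ∑ a, c a • S a ∧ ∑ a, |c a| = Γ) ∧
    (∀ (k : ℕ) (c : Fin k → ℝ) (S : Fin k → Matrix (Fin N) (Fin N) ℝ),
        (∀ a, (∀ i j, 0 ≤ S a i j) ∧ ∀ j, ∑ i, S a i j = 1) →
        A⁻¹ = ∑ a, c a • S a → Γ ≤ ∑ a, |c a|) := by
  set B := A⁻¹
  have hB : ∀ j, ∑ i, B i j = 1 := Matrix.sum_inv_col_eq_one hA hAcol
  obtain ⟨⟨y₀, hy₀⟩, hmax⟩ := hΓ
  refine ⟨?_, fun k c S hS h => ?_⟩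
  · have hle : ∀ y, ∑ x, |B x y| ≤ Γ := fun y => hmax ⟨y, rfl⟩
    have hΓ1 : 1 ≤ Γ := by
      rw [hy₀, ← hB y₀]
      exact Finset.sum_le_sum fun x _ => le_abs_self _
    let R : Matrix (Fin N) (Fin N) ℝ := Matrix.diagonal fun y => (Γ - ∑ x, |B x y|) / 2
    have hR : ∀ i j, 0 ≤ R i j := fun i j => by
      simp only [R, Matrix.diagonal_apply]
      split_ifs
      · linarith [hle i]
      · rfl
    have hRcol : ∀ j, ∑ i, R i j = (Γ - ∑ x, |B x j|) / 2 := fun j => by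
      simp [R, Matrix.diagonal_apply]
    obtain ⟨S, hS, hPS⟩ := Matrix.exists_colStochastic_smul_eq (q := (Γ + 1) / 2)
      (M := Matrix.of fun i j => (|B i j| + B i j) / 2 + R i j) (by linarith)
      (fun i j => by
        rw [Matrix.of_apply]
        linarith [hR i j, neg_abs_le (B i j)])
      (fun j => by
        simp only [Matrix.of_apply, Finset.sum_add_distrib, ← Finset.sum_div, hRcol, hB]
        ring)
    obtain ⟨T, hT, hQT⟩ := Matrix.exists_colStochastic_smul_eq (q := (Γ - 1) / 2)
      (M := Matrix.of fun i j => (|B i j| - B i j) / 2 + R i j) (by linarith)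
      (fun i j => by
        rw [Matrix.of_apply]
        linarith [hR i j, le_abs_self (B i j)])
      (fun j => by
        simp only [Matrix.of_apply, Finset.sum_add_distrib, Finset.sum_sub_distrib,
          ← Finset.sum_div, hRcol, hB]
        ring)
    refine ⟨2, ![(Γ + 1) / 2, -((Γ - 1) / 2)], ![S, T], ?_, ?_, ?_⟩
    · rw [Fin.forall_fin_two]
      exact ⟨hS, hT⟩
    · simp only [Fin.sum_univ_two, Matrix.cons_val_zero, Matrix.cons_val_one, neg_smul,
        ← hPS, ← hQT]
      ext i j
      simp only [Matrix.add_apply, Matrix.neg_apply, Matrix.of_apply]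
      ring
    · simp only [Fin.sum_univ_two, Matrix.cons_val_zero, Matrix.cons_val_one, abs_neg]
      rw [abs_of_nonneg (by linarith), abs_of_nonneg (by linarith)]
      ring
  · calc Γ = ∑ x, |∑ a, c a * S a x y₀| := by
          rw [hy₀, h]
          simp [Matrix.sum_apply]
      _ ≤ ∑ x, ∑ a, |c a| * S a x y₀ := by
          gcongr with x
          refine (Finset.abs_sum_le_sum_abs _ _).trans_eq (Finset.sum_congr rfl fun a _ => ?_)
          rw [abs_mul, abs_of_nonneg ((hS a).1 x y₀)]
      _ = ∑ a, |c a| := by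
          rw [Finset.sum_comm]
          simp [← Finset.mul_sum, (hS _).2]
end

section
/- For j = 1,…,n let ε_j, η_j ≥ 0 with ε_j + η_j < 1, let A_j = [[1−ε_j, η_j],[ε_j, 1−η_j]], and let A = A_1 ⊗ ⋯ ⊗ A_n be their Kronecker product (a 2ⁿ×2ⁿ column-stochastic matrix, which is invertible). Then Γ = max_y Σ_x |(A⁻¹)_{x,y}| = Π_{j=1}^{n} (1 + |ε_j − η_j|)/(1 − ε_j − η_j), where the maximum and sum range over {0,1}ⁿ. -/
open Finset

/-- The iterated Kronecker product of a finite family of matrices. -/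
def piKronecker {ι κ R : Type*} [Fintype ι] [CommSemiring R]
    (M : ι → Matrix κ κ R) : Matrix (ι → κ) (ι → κ) R :=
  Matrix.of fun y x => ∏ j, M j (y j) (x j)

theorem piKronecker_mul {ι κ R : Type*} [Fintype ι] [DecidableEq ι] [Fintype κ]
    [CommSemiring R] (M N : ι → Matrix κ κ R) :
    piKronecker M * piKronecker N = piKronecker fun j => M j * N j := by
  ext y x
  simp only [piKronecker, Matrix.mul_apply, Matrix.of_apply, ← Finset.prod_mul_distrib]
  rw [Finset.prod_univ_sum, Fintype.piFinset_univ]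

theorem piKronecker_one {ι κ R : Type*} [Fintype ι] [DecidableEq κ] [CommSemiring R] :
    piKronecker (fun _ : ι => (1 : Matrix κ κ R)) = 1 := by
  ext y x
  by_cases h : y = x
  · subst h
    simp [piKronecker]
  · obtain ⟨j, hj⟩ := Function.ne_iff.mp h
    rw [Matrix.one_apply_ne h]
    exact Finset.prod_eq_zero (Finset.mem_univ j) (Matrix.one_apply_ne hj)

theorem sum_abs_piKronecker {ι κ R : Type*} [Fintype ι] [DecidableEq ι] [Fintype κ]
    [CommRing R] [LinearOrder R] [IsStrictOrderedRing R]
    (M : ι → Matrix κ κ R) (y : ι → κ) :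
    ∑ x, |piKronecker M x y| = ∏ j, ∑ a, |M j a (y j)| := by
  simp only [piKronecker, Matrix.of_apply, Finset.abs_prod]
  rw [Finset.prod_univ_sum, Fintype.piFinset_univ]

/-- The inverse of the single-bit noise matrix `[[1-ε, η],[ε, 1-η]]`. -/
noncomputable def bitNoiseInv (ε η : ℝ) : Matrix (Fin 2) (Fin 2) ℝ :=
  (1 - ε - η)⁻¹ • !![1 - η, -η; -ε, 1 - ε]

theorem bitNoise_mul_bitNoiseInv {ε η : ℝ} (h : ε + η < 1) :
    !![1 - ε, η; ε, 1 - η] * bitNoiseInv ε η = 1 := by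
  have hd : 1 - ε - η ≠ 0 := by linarith
  ext i j
  fin_cases i <;> fin_cases j <;>
    simp [bitNoiseInv, Matrix.mul_apply, Fin.sum_univ_two] <;> field_simp <;> ring

theorem sum_abs_bitNoiseInv {ε η : ℝ} (hε : 0 ≤ ε) (hη : 0 ≤ η) (h : ε + η < 1) (b : Fin 2) :
    ∑ a, |bitNoiseInv ε η a b| =
      (if b = 0 then 1 + (ε - η) else 1 - (ε - η)) / (1 - ε - η) := by
  have hd : 0 < 1 - ε - η := by linarith
  have hε' : 0 ≤ 1 - ε := by linarith
  have hη' : 0 ≤ 1 - η := by linarith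
  fin_cases b <;>
    simp [bitNoiseInv, Fin.sum_univ_two, abs_mul, abs_of_pos hd, abs_of_nonneg, hε, hη, hε', hη'] <;>
    field_simp <;> ring

theorem sum_abs_bitNoiseInv_le {ε η : ℝ} (hε : 0 ≤ ε) (hη : 0 ≤ η) (h : ε + η < 1) (b : Fin 2) :
    ∑ a, |bitNoiseInv ε η a b| ≤ (1 + |ε - η|) / (1 - ε - η) := by
  have hd : 0 ≤ 1 - ε - η := by linarith
  rw [sum_abs_bitNoiseInv hε hη h]
  refine div_le_div_of_nonneg_right ?_ hd
  split_ifs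
  · linarith [le_abs_self (ε - η)]
  · linarith [neg_le_abs (ε - η)]

theorem exists_sum_abs_bitNoiseInv_eq {ε η : ℝ} (hε : 0 ≤ ε) (hη : 0 ≤ η) (h : ε + η < 1) :
    ∃ b, ∑ a, |bitNoiseInv ε η a b| = (1 + |ε - η|) / (1 - ε - η) := by
  rcases le_total 0 (ε - η) with hs | hs
  · exact ⟨0, by rw [sum_abs_bitNoiseInv hε hη h, if_pos rfl, abs_of_nonneg hs]⟩
  · exact ⟨1, by rw [sum_abs_bitNoiseInv hε hη h, if_neg one_ne_zero, abs_of_nonpos hs,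
      ← sub_eq_add_neg]⟩

/-- For the tensor product noise model `A = A_1 ⊗ ⋯ ⊗ A_n` with
`A_j = [[1-ε_j, η_j],[ε_j, 1-η_j]]`, the matrix `A` is invertible and
`Γ = max_y ∑_x |(A⁻¹)_{x,y}| = ∏_j (1 + |ε_j - η_j|)/(1 - ε_j - η_j)`. -/
theorem gamma_tensor_product_noise
    (n : ℕ) (ε η : Fin n → ℝ)
    (hε : ∀ j, 0 ≤ ε j) (hη : ∀ j, 0 ≤ η j) (h1 : ∀ j, ε j + η j < 1)
    (A : Matrix (Fin n → Fin 2) (Fin n → Fin 2) ℝ)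
    (hA : ∀ y x, A y x =
      ∏ j, (!![1 - ε j, η j; ε j, 1 - η j] : Matrix (Fin 2) (Fin 2) ℝ) (y j) (x j)) :
    IsUnit A.det ∧
    IsGreatest {g : ℝ | ∃ y, g = ∑ x, |(A⁻¹) x y|}
      (∏ j, (1 + |ε j - η j|) / (1 - ε j - η j)) := by
  have hmul : A * piKronecker (fun j => bitNoiseInv (ε j) (η j)) = 1 := by
    have hA' : A = piKronecker fun j => !![1 - ε j, η j; ε j, 1 - η j] := Matrix.ext hA
    simp only [hA', piKronecker_mul, bitNoise_mul_bitNoiseInv (h1 _), piKronecker_one]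
  refine ⟨Matrix.isUnit_det_of_right_inverse hmul, ?_⟩
  simp only [Matrix.inv_eq_right_inv hmul, sum_abs_piKronecker]
  constructor
  · choose y hy using fun j => exists_sum_abs_bitNoiseInv_eq (hε j) (hη j) (h1 j)
    exact ⟨y, Finset.prod_congr rfl fun j _ => (hy j).symm⟩
  · rintro _ ⟨y, rfl⟩
    exact Finset.prod_le_prod (fun j _ => Finset.sum_nonneg fun a _ => abs_nonneg _)
      fun j _ => sum_abs_bitNoiseInv_le (hε j) (hη j) (h1 j) (y j)
end

section
/- Let ε, η ≥ 0 with ε + η < 1 and let A = [[1−ε, η],[ε, 1−η]]. Define c₀ = (2−ε−η)/(2(1−ε−η)), c₁ = −(ε+η)/(2(1−ε−η)), c₂ = (ε−η)/(2(1−ε−η)), c₃ = (η−ε)/(2(1−ε−η)), and the 2×2 column-stochastic matrices V₀ = [[1,0],[0,1]] (identity), V₁ = [[0,1],[1,0]] (bit flip), V₂ = [[1,1],[0,0]] (reset to 0), V₃ = [[0,0],[1,1]] (reset to 1). Then A⁻¹ = c₀V₀ + c₁V₁ + c₂V₂ + c₃V₃, and |c₀| + |c₁| + |c₂| + |c₃|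 = (1 + |ε−η|)/(1−ε−η). -/
open Finset

/-- Quasi-probability decomposition of the inverse single-qubit noise matrix
into the identity, bit flip, reset-to-0 and reset-to-1 stochastic matrices,
together with the value of the coefficient 1-norm. -/
theorem single_qubit_quasiprob_decomposition
    (ε η : ℝ) (hε : 0 ≤ ε) (hη : 0 ≤ η) (h1 : ε + η < 1) :
    (!![1 - ε, η; ε, 1 - η] : Matrix (Fin 2) (Fin 2) ℝ)⁻¹ =
        ((2 - ε - η) / (2 * (1 - ε - η))) • (!![1, 0; 0, 1] : Matrix (Fin 2) (Fin 2) ℝ)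
      + (-(ε + η) / (2 * (1 - ε - η))) • (!![0, 1; 1, 0] : Matrix (Fin 2) (Fin 2) ℝ)
      + ((ε - η) / (2 * (1 - ε - η))) • (!![1, 1; 0, 0] : Matrix (Fin 2) (Fin 2) ℝ)
      + ((η - ε) / (2 * (1 - ε - η))) • (!![0, 0; 1, 1] : Matrix (Fin 2) (Fin 2) ℝ) ∧
    |(2 - ε - η) / (2 * (1 - ε - η))| + |(-(ε + η)) / (2 * (1 - ε - η))|
      + |(ε - η) / (2 * (1 - ε - η))| + |(η - ε) / (2 * (1 - ε - η))|
      = (1 + |ε - η|) / (1 - ε - η) := by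
  have hD : 0 < 1 - ε - η := by linarith
  have hD2 : 0 < 2 * (1 - ε - η) := by linarith
  have hne : 1 - ε - η ≠ 0 := hD.ne'
  constructor
  · apply Matrix.inv_eq_right_inv
    ext i j
    fin_cases i <;> fin_cases j <;>
      simp [Matrix.mul_apply, Fin.sum_univ_two] <;> field_simp <;> ring
  · rw [abs_div, abs_div, abs_div, abs_div, abs_of_pos hD2, abs_neg, abs_sub_comm η ε,
      abs_of_nonneg (by linarith : 0 ≤ 2 - ε - η), abs_of_nonneg (by linarith : 0 ≤ ε + η)]
    field_simp
    ring
end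

section
/- Let O : {1,…,N} → ℝ satisfy |O(x)| ≤ 1 for all x, let s¹,…,s^M ∈ {1,…,N} be fixed, and let A⁻¹ = Σ_{α} c_α S_α be a finite decomposition where each S_α is a column-stochastic N×N matrix and c_α are real with ‖c‖₁ = Σ_α |c_α| > 0. Consider the random variable Y = ‖c‖₁·sgn(c_α)·O(x) generated as follows: i is uniform on {1,…,M}, α is drawn with probability |c_α|/‖c‖₁, and x is drawn from the probability vector given by column sⁱ of S_α (i.e., P(x) = (S_α)_{x,sⁱ}). Then E[Y] = M⁻¹ Σ_{i=1}^{M} Σ_x O(x)·(A⁻¹)_{x,sⁱ}, and the variance of Y is at most ‖c‖₁². -/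
open Finset

/-- A weighted variance is at most the square of any uniform bound on the variable. -/
theorem weighted_variance_le_sq {ι : Type*} [Fintype ι] (w Y : ι → ℝ) (L : ℝ)
    (hw0 : ∀ p, 0 ≤ w p) (hw1 : ∑ p, w p = 1) (hY : ∀ p, |Y p| ≤ L) :
    ∑ p, w p * (Y p - ∑ q, w q * Y q) ^ 2 ≤ L ^ 2 := by
  set m := ∑ q, w q * Y q with hm
  have hexp : ∑ p, w p * (Y p - m) ^ 2 = ∑ p, w p * Y p ^ 2 - m ^ 2 := by
    calc ∑ p, w p * (Y p - m) ^ 2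
        = ∑ p, (w p * Y p ^ 2 - 2 * m * (w p * Y p) + m ^ 2 * w p) :=
          Finset.sum_congr rfl fun p _ => by ring
      _ = ∑ p, w p * Y p ^ 2 - 2 * m * m + m ^ 2 * 1 := by
          rw [Finset.sum_add_distrib, Finset.sum_sub_distrib, ← Finset.mul_sum,
            ← Finset.mul_sum, hw1, ← hm]
      _ = ∑ p, w p * Y p ^ 2 - m ^ 2 := by ring
  have hsecond : ∑ p, w p * Y p ^ 2 ≤ L ^ 2 :=
    calc ∑ p, w p * Y p ^ 2 ≤ ∑ p, w p * L ^ 2 :=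
          Finset.sum_le_sum fun p _ =>
            mul_le_mul_of_nonneg_left (sq_le_sq' (abs_le.mp (hY p)).1 (abs_le.mp (hY p)).2) (hw0 p)
      _ = L ^ 2 := by rw [← Finset.sum_mul, hw1, one_mul]
  rw [hexp]
  linarith [sq_nonneg m]

theorem abs_mul_real_sign (r : ℝ) : |r| * Real.sign r = r := by
  rcases lt_trichotomy r 0 with h | h | h
  · simp [Real.sign_of_neg h, abs_of_neg h]
  · simp [h]
  · simp [Real.sign_of_pos h, abs_of_pos h]

theorem abs_real_sign_le_one (r : ℝ) : |Real.sign r| ≤ 1 := by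
  rcases Real.sign_apply_eq r with h | h | h <;> simp [h]

/-- The random variable `Y = ‖c‖₁ · sgn(c_α) · O(x)` produced by Algorithm 1,
with `i` uniform, `α ∼ |c_α|/‖c‖₁` and `x` drawn from column `sⁱ` of `S_α`,
is an unbiased estimator of `ξ = M⁻¹ ∑_i ∑_x O(x) (A⁻¹)_{x,sⁱ}` with variance
at most `‖c‖₁²`. -/
theorem algorithm_one_estimator
    (N M k : ℕ) (hM : 0 < M)
    (O : Fin N → ℝ) (hO : ∀ x, |O x| ≤ 1) (s : Fin M → Fin N)
    (A : Matrix (Fin N) (Fin N) ℝ)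
    (c : Fin k → ℝ) (S : Fin k → Matrix (Fin N) (Fin N) ℝ)
    (hS : ∀ a, (∀ i j, 0 ≤ S a i j) ∧ ∀ j, ∑ i, S a i j = 1)
    (hdec : A⁻¹ = ∑ a, c a • S a) (hc : 0 < ∑ a, |c a|)
    (w : Fin M × Fin k × Fin N → ℝ)
    (hw : ∀ p, w p = (M : ℝ)⁻¹ * (|c p.2.1| / ∑ a, |c a|) * S p.2.1 p.2.2 (s p.1))
    (Y : Fin M × Fin k × Fin N → ℝ)
    (hY : ∀ p, Y p = (∑ a, |c a|) * Real.sign (c p.2.1) * O p.2.2) :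
    (∑ p, w p * Y p = (M : ℝ)⁻¹ * ∑ i, ∑ x, O x * (A⁻¹) x (s i)) ∧
    ∑ p, w p * (Y p - ∑ q, w q * Y q) ^ 2 ≤ (∑ a, |c a|) ^ 2 := by
  set L := ∑ a, |c a| with hL
  have hM' : (M : ℝ) ≠ 0 := by exact_mod_cast hM.ne'
  refine ⟨?_, weighted_variance_le_sq w Y L (fun p => ?_) ?_ fun p => ?_⟩
  · have hterm : ∀ p, w p * Y p =
        (M : ℝ)⁻¹ * (O p.2.2 * (c p.2.1 * S p.2.1 p.2.2 (s p.1))) := fun p => by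
      rw [hw, hY]
      calc _ = (M : ℝ)⁻¹ * (O p.2.2 * ((|c p.2.1| * Real.sign (c p.2.1)) *
            S p.2.1 p.2.2 (s p.1))) * (L / L) := by ring
        _ = _ := by rw [abs_mul_real_sign, div_self hc.ne', mul_one]
    simp_rw [hterm, Fintype.sum_prod_type, ← Finset.mul_sum]
    congr 1
    refine Finset.sum_congr rfl fun i _ => ?_
    rw [Finset.sum_comm]
    simp [hdec, Matrix.sum_apply, Finset.mul_sum]
  · rw [hw]
    have := (hS p.2.1).1 p.2.2 (s p.1)
    positivity
  · simp_rw [hw, Fintype.sum_prod_type, ← Finset.mul_sum, (hS _).2, mul_one,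
      ← Finset.mul_sum, ← Finset.sum_div, ← hL]
    simp [hM', hc.ne']
  · rw [hY, abs_mul, abs_mul, abs_of_pos hc, mul_assoc]
    exact mul_le_of_le_one_right hc.le
      (mul_le_one₀ (abs_real_sign_le_one _) (abs_nonneg _) (hO _))
end

section
/- Let p ≥ 2 and n be integers with 1 ≤ n < 2^p. For each a ∈ {0,1,…,2^p−1} with binary digits a₁,…,a_p, define x^a ∈ {0,1}ⁿ by x^a_b = Σ_{i=1}^{p} a_i·b_i (mod 2) for b = 1,…,n, where b₁,…,b_p are the binary digits of b. Then for any two distinct indices b, b′ ∈ {1,…,n} and any pair of bit values (v,w) ∈ {0,1}², exactly 2^{p−2} values of a ∈ {0,1,…,2^p−1} satisfy x^a_b = v and x^a_{b′} = w. -/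
open Finset

theorem sum_range_two_mul {M : Type*} [AddCommMonoid M] (g : ℕ → M) (m : ℕ) :
    ∑ a ∈ range (2 * m), g a = ∑ a ∈ range m, (g (2 * a) + g (2 * a + 1)) := by
  induction m with
  | zero => simp
  | succ m ih =>
    rw [mul_add_one, sum_range_succ, sum_range_succ, ih, sum_range_succ, add_assoc]

theorem sum_neg_one_pow_binary_digits (p : ℕ) (c : ℕ → ℕ) :
    ∑ a ∈ range (2 ^ p), (-1 : ℤ) ^ (∑ i ∈ range p, (a / 2 ^ i % 2) * c i)
      = ∏ i ∈ range p, (1 + (-1 : ℤ) ^ c i) := by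
  induction p generalizing c with
  | zero => simp
  | succ p ih =>
    rw [pow_succ', sum_range_two_mul, prod_range_succ', ← ih (fun i => c (i + 1)), sum_mul]
    refine sum_congr rfl fun a _ => ?_
    have h0 : ∀ i, 2 * a / 2 ^ (i + 1) = a / 2 ^ i := fun i => by
      rw [pow_succ', ← Nat.div_div_eq_div_mul]; congr 1; omega
    have h1 : ∀ i, (2 * a + 1) / 2 ^ (i + 1) = a / 2 ^ i := fun i => by
      rw [pow_succ', ← Nat.div_div_eq_div_mul]; congr 1; omega
    have h2 : (2 * a + 1) % 2 = 1 := by omega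
    simp only [sum_range_succ', h0, h1, pow_zero, Nat.div_one, Nat.mul_mod_right, h2]
    rw [zero_mul, add_zero, one_mul, pow_add]
    ring

theorem sum_neg_one_pow_binary_digits_eq_zero {p : ℕ} {c : ℕ → ℕ}
    (h : ∃ i < p, Odd (c i)) :
    ∑ a ∈ range (2 ^ p), (-1 : ℤ) ^ (∑ i ∈ range p, (a / 2 ^ i % 2) * c i) = 0 := by
  obtain ⟨i, hi, hc⟩ := h
  rw [sum_neg_one_pow_binary_digits]
  exact prod_eq_zero (mem_range.2 hi) (by simp [hc.neg_one_pow])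

theorem exists_binary_digit_ne {p b b' : ℕ} (hb : b < 2 ^ p) (hb' : b' < 2 ^ p)
    (hne : b ≠ b') : ∃ i < p, b / 2 ^ i % 2 ≠ b' / 2 ^ i % 2 := by
  by_contra! h
  refine hne (Nat.eq_of_testBit_eq fun i => ?_)
  rcases lt_or_ge i p with hi | hi
  · simp [Nat.testBit_eq_decide_div_mod_eq, h i hi]
  · have hpow : 2 ^ p ≤ 2 ^ i := Nat.pow_le_pow_right two_pos hi
    rw [Nat.testBit_lt_two_pow (hb.trans_le hpow), Nat.testBit_lt_two_pow (hb'.trans_le hpow)]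

theorem four_mul_indicator_parity {v w : ℕ} (hv : v ≤ 1) (hw : w ≤ 1) (s t : ℕ) :
    4 * (if s % 2 = v ∧ t % 2 = w then (1 : ℤ) else 0)
      = 1 + (-1) ^ v * (-1) ^ s + (-1) ^ w * (-1) ^ t + (-1) ^ (v + w) * (-1) ^ (s + t) := by
  rw [pow_add _ s t, neg_one_pow_eq_pow_mod_two s, neg_one_pow_eq_pow_mod_two t]
  rcases Nat.mod_two_eq_zero_or_one s with hs | hs <;>
    rcases Nat.mod_two_eq_zero_or_one t with ht | ht <;>
    interval_cases v <;> interval_cases w <;> simp [hs, ht]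

/-- Hadamard calibration: for `2 ≤ p`, `1 ≤ n < 2^p`, the strings
`x^a_b = ∑_i a_i b_i (mod 2)` probe each pair of bit values on each pair of
distinct positions `b ≠ b'` in exactly `2^(p-2)` input states `a`. -/
theorem hadamard_calibration_balanced
    (p n : ℕ) (hp : 2 ≤ p) (hn1 : 1 ≤ n) (hn2 : n < 2 ^ p)
    (x : ℕ → ℕ → ℕ)
    (hx : ∀ a b, x a b = (∑ i ∈ Finset.range p, (a / 2 ^ i % 2) * (b / 2 ^ i % 2)) % 2)
    (b b' : ℕ) (hb : 1 ≤ b) (hbn : b ≤ n) (hb' : 1 ≤ b') (hb'n : b' ≤ n)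
    (hne : b ≠ b') (v w : ℕ) (hv : v ≤ 1) (hw : w ≤ 1) :
    ((Finset.range (2 ^ p)).filter (fun a => x a b = v ∧ x a b' = w)).card
      = 2 ^ (p - 2) := by
  have hb2 : b < 2 ^ p := hbn.trans_lt hn2
  have hb'2 : b' < 2 ^ p := hb'n.trans_lt hn2
  have exists_odd : ∀ c, 1 ≤ c → c < 2 ^ p → ∃ i < p, Odd (c / 2 ^ i % 2) := by
    intro c hc hc2
    obtain ⟨i, hi, h⟩ := exists_binary_digit_ne hc2 (Nat.two_pow_pos p) (by omega : c ≠ 0)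
    refine ⟨i, hi, ?_⟩
    rw [Nat.zero_div] at h
    rw [Nat.odd_iff]
    omega
  have exists_odd_add : ∃ i < p, Odd (b / 2 ^ i % 2 + b' / 2 ^ i % 2) := by
    obtain ⟨i, hi, h⟩ := exists_binary_digit_ne hb2 hb'2 hne
    refine ⟨i, hi, ?_⟩
    rw [Nat.odd_iff]
    omega
  have hcard : (4 : ℤ) * ((Finset.range (2 ^ p)).filter
      (fun a => x a b = v ∧ x a b' = w)).card = 2 ^ p := by
    rw [card_filter]
    push_cast
    simp only [hx, mul_sum (range (2 ^ p)), four_mul_indicator_parity hv hw, sum_add_distrib]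
    simp only [← mul_sum (range (2 ^ p)), ← sum_add_distrib (s := range p), ← mul_add,
      sum_neg_one_pow_binary_digits_eq_zero (exists_odd b hb hb2),
      sum_neg_one_pow_binary_digits_eq_zero (exists_odd b' hb' hb'2),
      sum_neg_one_pow_binary_digits_eq_zero exists_odd_add]
    simp
  obtain ⟨q, rfl⟩ := Nat.exists_eq_add_of_le' hp
  rw [Nat.add_sub_cancel]
  have hnat : 4 * ((Finset.range (2 ^ (q + 2))).filter
      (fun a => x a b = v ∧ x a b' = w)).card = 2 ^ (q + 2) := by exact_mod_cast hcard
  exact Nat.eq_of_mul_eq_mul_left four_pos (hnat.trans (by ring))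
end

section
/- Let A be an invertible column-stochastic N×N real matrix, P a probability vector on {1,…,N}, and O : {1,…,N} → ℝ with |O(x)| ≤ 1 for all x. Let Γ = max_y Σ_x |(A⁻¹)_{x,y}| and let δ > 0. If s¹,…,s^M are independent random variables each distributed according to A·P with M ≥ 4·δ⁻²·Γ², then the estimator ξ = M⁻¹ Σ_{i=1}^{M} Σ_x O(x)·(A⁻¹)_{x,sⁱ} satisfies |ξ − Σ_x O(x)·P(x)| ≤ δ with probability at least 2/3. -/
open Finset

/-- Fubini for finite sums over `Fin (n + 1) → α`, splitting off the first coordinate. -/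
lemma sum_fin_succ_pi {α : Type*} [Fintype α] (n : ℕ) (F : (Fin (n + 1) → α) → ℝ) :
    ∑ s, F s = ∑ a, ∑ t : Fin n → α, F (Fin.cons a t) := by
  rw [← Fintype.sum_prod_type']
  exact (Fintype.sum_equiv (Fin.consEquiv fun _ => α) _ _ fun _ => rfl).symm

/-- Product weights built from weights of total mass one have total mass one. -/
lemma sum_prod_weights {α : Type*} [Fintype α] (q : α → ℝ) (hq : ∑ a, q a = 1) (n : ℕ) :
    ∑ s : Fin n → α, ∏ i, q (s i) = 1 := by
  induction n with
  | zero => simp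
  | succ n ih =>
    rw [sum_fin_succ_pi]
    simp [Fin.prod_univ_succ, ← mul_sum, ih, hq]

/-- A sum of independent centred variables is centred. -/
lemma sum_prod_weights_mul_sum {α : Type*} [Fintype α] (q g : α → ℝ) (hq : ∑ a, q a = 1)
    (hg : ∑ a, q a * g a = 0) (n : ℕ) :
    ∑ s : Fin n → α, (∏ i, q (s i)) * ∑ i, g (s i) = 0 := by
  induction n with
  | zero => simp
  | succ n ih =>
    rw [sum_fin_succ_pi]
    have h : ∀ a, ∑ t : Fin n → α, q a * (∏ i, q (t i)) * (g a + ∑ i, g (t i)) = q a * g a := by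
      intro a
      calc _ = q a * g a * ∑ t : Fin n → α, ∏ i, q (t i)
            + q a * ∑ t : Fin n → α, (∏ i, q (t i)) * ∑ i, g (t i) := by
            rw [mul_sum, mul_sum, ← sum_add_distrib]
            exact sum_congr rfl fun t _ => by ring
        _ = q a * g a := by rw [ih, sum_prod_weights q hq]; ring
    simp [Fin.prod_univ_succ, Fin.sum_univ_succ, h, hg]

/-- The variance of a sum of independent identically distributed centred variables. -/
lemma sum_prod_weights_mul_sum_sq {α : Type*} [Fintype α] (q g : α → ℝ) (hq : ∑ a, q a = 1)
    (hg : ∑ a, q a * g a = 0) (n : ℕ) :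
    ∑ s : Fin n → α, (∏ i, q (s i)) * (∑ i, g (s i)) ^ 2 = n * ∑ a, q a * g a ^ 2 := by
  induction n with
  | zero => simp
  | succ n ih =>
    rw [sum_fin_succ_pi]
    have h : ∀ a, ∑ t : Fin n → α, q a * (∏ i, q (t i)) * (g a + ∑ i, g (t i)) ^ 2
        = q a * g a ^ 2 + q a * (n * ∑ a, q a * g a ^ 2) := by
      intro a
      calc _ = q a * g a ^ 2 * ∑ t : Fin n → α, ∏ i, q (t i)
            + 2 * q a * g a * ∑ t : Fin n → α, (∏ i, q (t i)) * ∑ i, g (t i)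
            + q a * ∑ t : Fin n → α, (∏ i, q (t i)) * (∑ i, g (t i)) ^ 2 := by
            rw [mul_sum, mul_sum, mul_sum, ← sum_add_distrib, ← sum_add_distrib]
            exact sum_congr rfl fun t _ => by ring
        _ = _ := by
            rw [ih, sum_prod_weights q hq, sum_prod_weights_mul_sum q g hq hg]; ring
    simp only [Fin.prod_univ_succ, Fin.sum_univ_succ, Fin.cons_zero, Fin.cons_succ, h,
      sum_add_distrib, ← sum_mul, hq]
    push_cast
    ring

open Classical in
/-- If `M ≥ 4 δ⁻² Γ²` then the error-mitigated estimator `ξ` is within `δ` of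
the ideal mean value with probability at least `2/3`, the probability being
over i.i.d. samples `s¹,…,s^M` distributed according to `A·P`. -/
theorem error_mitigation_success_probability
    (N M : ℕ) (hM0 : 0 < M)
    (A : Matrix (Fin N) (Fin N) ℝ) (hA : IsUnit A.det)
    (hAnonneg : ∀ i j, 0 ≤ A i j) (hAcol : ∀ j, ∑ i, A i j = 1)
    (P : Fin N → ℝ) (hP : ∀ x, 0 ≤ P x) (hP1 : ∑ x, P x = 1)
    (O : Fin N → ℝ) (hO : ∀ x, |O x| ≤ 1)
    (Γ : ℝ) (hΓ : IsGreatest {g : ℝ | ∃ y, g = ∑ x, |(A⁻¹) x y|} Γ)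
    (δ : ℝ) (hδ : 0 < δ) (hM : 4 * δ⁻¹ ^ 2 * Γ ^ 2 ≤ (M : ℝ))
    (ξ : (Fin M → Fin N) → ℝ)
    (hξ : ∀ s, ξ s = (M : ℝ)⁻¹ * ∑ i, ∑ x, O x * (A⁻¹) x (s i)) :
    (2 : ℝ) / 3 ≤
      ∑ s : Fin M → Fin N,
        (∏ i, ∑ x, A (s i) x * P x) *
          (if |ξ s - ∑ x, O x * P x| ≤ δ then (1 : ℝ) else 0) := by
  set q : Fin N → ℝ := fun y => ∑ x, A y x * P x with hq_def
  set f : Fin N → ℝ := fun y => ∑ x, O x * A⁻¹ x y with hf_def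
  set m : ℝ := ∑ x, O x * P x
  have hq_nonneg : ∀ y, 0 ≤ q y := fun y =>
    sum_nonneg fun x _ => mul_nonneg (hAnonneg y x) (hP x)
  have hq_sum : ∑ y, q y = 1 := by
    rw [hq_def, sum_comm]
    simp [← sum_mul, hAcol, hP1]
  have hqf : ∑ y, q y * f y = m := by
    have hinv : A⁻¹.mulVec (A.mulVec P) = P := by
      rw [Matrix.mulVec_mulVec, Matrix.nonsing_inv_mul A hA, Matrix.one_mulVec]
    calc ∑ y, q y * f y = ∑ y, ∑ x, O x * (A⁻¹ x y * q y) := by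
          refine sum_congr rfl fun y _ => ?_
          rw [hf_def, mul_sum]
          exact sum_congr rfl fun x _ => by ring
      _ = ∑ x, O x * A⁻¹.mulVec (A.mulVec P) x := by
          rw [sum_comm]
          exact sum_congr rfl fun x _ => (mul_sum _ _ _).symm
      _ = m := by rw [hinv]
  have hf_abs : ∀ y, |f y| ≤ Γ := fun y =>
    calc |f y| ≤ ∑ x, |O x * A⁻¹ x y| := abs_sum_le_sum_abs _ _
      _ ≤ ∑ x, |A⁻¹ x y| := sum_le_sum fun x _ => by
          rw [abs_mul]
          exact mul_le_of_le_one_left (abs_nonneg _) (hO x)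
      _ ≤ Γ := hΓ.2 ⟨y, rfl⟩
  have hcentred : ∑ y, q y * (f y - m) = 0 := by
    simp only [mul_sub, sum_sub_distrib, ← sum_mul, hqf, hq_sum, one_mul, sub_self]
  have hvar : ∑ y, q y * (f y - m) ^ 2 ≤ Γ ^ 2 := by
    have hsplit : ∑ y, q y * (f y - m) ^ 2 = ∑ y, q y * f y ^ 2 - m ^ 2 := by
      calc _ = ∑ y, (q y * f y ^ 2 - 2 * m * (q y * f y) + m ^ 2 * q y) :=
            sum_congr rfl fun y _ => by ring
        _ = _ := by
            rw [sum_add_distrib, sum_sub_distrib, ← mul_sum, ← mul_sum, hqf, hq_sum]; ring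
    have hsecond : ∑ y, q y * f y ^ 2 ≤ Γ ^ 2 := by
      calc _ ≤ ∑ y, q y * Γ ^ 2 := sum_le_sum fun y _ =>
            mul_le_mul_of_nonneg_left
              (sq_le_sq.2 ((hf_abs y).trans (le_abs_self Γ))) (hq_nonneg y)
        _ = Γ ^ 2 := by rw [← sum_mul, hq_sum, one_mul]
    linarith [sq_nonneg m]
  have hMpos : (0 : ℝ) < M := by exact_mod_cast hM0
  have hξ_sub : ∀ s, ξ s - m = (M : ℝ)⁻¹ * ∑ i, (f (s i) - m) := by
    intro s
    rw [hξ, sum_sub_distrib, sum_const, card_univ, Fintype.card_fin, nsmul_eq_mul, mul_sub,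
      inv_mul_cancel_left₀ hMpos.ne']
  have hchebyshev : ∀ s, 1 - (ξ s - m) ^ 2 / δ ^ 2 ≤
      if |ξ s - m| ≤ δ then (1 : ℝ) else 0 := by
    intro s
    split_ifs with h
    · exact sub_le_self _ (by positivity)
    · have : δ ^ 2 ≤ (ξ s - m) ^ 2 := by
        rw [← sq_abs (ξ s - m)]
        exact pow_le_pow_left₀ hδ.le (not_le.1 h).le 2
      linarith [(one_le_div (by positivity : 0 < δ ^ 2)).2 this]
  have hΓM : Γ ^ 2 / (M * δ ^ 2) ≤ 1 / 4 := by
    rw [div_le_iff₀ (by positivity)]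
    have h := mul_le_mul_of_nonneg_right hM (sq_nonneg δ)
    have : 4 * δ⁻¹ ^ 2 * Γ ^ 2 * δ ^ 2 = 4 * Γ ^ 2 := by field_simp
    linarith
  calc (2 : ℝ) / 3 ≤ 1 - Γ ^ 2 / (M * δ ^ 2) := by linarith
    _ ≤ 1 - (∑ y, q y * (f y - m) ^ 2) / (M * δ ^ 2) := by gcongr
    _ = ∑ s : Fin M → Fin N, (∏ i, q (s i)) * (1 - (ξ s - m) ^ 2 / δ ^ 2) := by
        have hsum := sum_prod_weights_mul_sum_sq q (fun y => f y - m) hq_sum hcentred M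
        calc _ = 1 - (∑ s : Fin M → Fin N, (∏ i, q (s i)) * (∑ i, (f (s i) - m)) ^ 2)
                * ((M : ℝ) ^ 2 * δ ^ 2)⁻¹ := by
              rw [hsum]; field_simp
          _ = _ := by
              rw [← sum_prod_weights q hq_sum M, sum_mul, ← sum_sub_distrib]
              refine sum_congr rfl fun s _ => ?_
              rw [hξ_sub, sum_prod_weights q hq_sum M]
              field_simp
    _ ≤ _ := sum_le_sum fun s _ =>
        mul_le_mul_of_nonneg_left (hchebyshev s) (prod_nonneg fun i _ => hq_nonneg _)
end
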